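/- Let G be a group, Σ = {x₁, …, x_d} a finite set, and ψ : G → G ≀_Σ Sym(Σ) an injective group homomorphism into the permutational wreath product, so that each g ∈ G has sections g_x ∈ G (x ∈ Σ) and action σ_g ∈ Sym(Σ) determined by ψ(g) = ((g_{x₁}, …, g_{x_d}), σ_g). Let S be a finite semigroup-generating set of G with positive weight π, let Δ be an essentially geodesic generating set (egg) for (G,S,π), and let η ∈ [0,1] be such that for every word δ ∈ Δ, with group element δ̄ represented by δ, one has Σ_{x ∈ Σ} ‖(δ̄)_x‖_{S,π} ≤ η·‖δ̄‖_{S,π}. Then there exists a constant c₀ > 0 such that for every g ∈ G, Σ_{x ∈ Σ} ‖g_x‖_{S,π} ≤ η·‖g‖_{S,π} + c₀. -/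

import Mathlib

/-- The `π`-length of a word `w` over the group `G`: the sum of the weights of its letters. -/
noncomputable def wlen {G : Type*} (π : G → ℝ) (w : List G) : ℝ := (w.map π).sum

/-- The weighted word norm of `g` with respect to the generating set `S` and weight `π`:
the infimum of the `π`-lengths of words over `S` evaluating to `g`. -/
noncomputable def wnorm {G : Type*} [Group G] (S : Set G) (π : G → ℝ) (g : G) : ℝ :=
  sInf {r : ℝ | ∃ w : List G, (∀ x ∈ w, x ∈ S) ∧ w.prod = g ∧ wlen π w = r}

/-- A finite set `Δ` of words over `S` is an essentially geodesic generating set (egg)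
for `(G,S,π)`. -/
def IsEgg {G : Type*} [Group G] (S : Set G) (π : G → ℝ) (Δ : Set (List G)) : Prop :=
  Δ.Finite ∧ (∀ w ∈ Δ, ∀ x ∈ w, x ∈ S) ∧
  ∃ F : Set (List G), F.Finite ∧ (∀ w ∈ F, ∀ x ∈ w, x ∈ S) ∧
    ∀ g : G, ∃ (ds : List (List G)) (h : List G),
      (∀ d ∈ ds, d ∈ Δ) ∧ h ∈ F ∧
      (ds.flatten ++ h).prod = g ∧ wlen π (ds.flatten ++ h) = wnorm S π g

/-- The data `(sec, act)` encodes an injective homomorphism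
`ψ : G → G ≀_Σ Sym(Σ)`, `ψ(g) = ((sec g x)_{x ∈ Σ}, act g)`, into the permutational
wreath product: `act` is a homomorphism, the section maps satisfy the wreath product
multiplication law `sec (g·h) x = sec g x · sec h ((act g)⁻¹ x)`, and `g ↦ (sec g, act g)`
is injective. -/
structure WreathEmbedding (G : Type*) [Group G] (Alp : Type*) where
  sec : G → Alp → G
  act : G →* Equiv.Perm Alp
  sec_one : ∀ x : Alp, sec 1 x = 1
  sec_mul : ∀ (g h : G) (x : Alp), sec (g * h) x = sec g x * sec h ((act g)⁻¹ x)
  inj : Function.Injective fun g => (sec g, act g)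

theorem wlen_append {G : Type*} (π : G → ℝ) (v w : List G) :
    wlen π (v ++ w) = wlen π v + wlen π w := by
  simp [wlen]

theorem wlen_nonneg {G : Type*} {S : Set G} {π : G → ℝ} (hπ : ∀ s ∈ S, 0 < π s)
    {w : List G} (hw : ∀ x ∈ w, x ∈ S) : 0 ≤ wlen π w := by
  refine List.sum_nonneg fun r hr => ?_
  obtain ⟨x, hx, rfl⟩ := List.mem_map.1 hr
  exact (hπ x (hw x hx)).le

theorem wnorm_prod_le {G : Type*} [Group G] {S : Set G} {π : G → ℝ} (hπ : ∀ s ∈ S, 0 < π s)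
    {w : List G} (hw : ∀ x ∈ w, x ∈ S) : wnorm S π w.prod ≤ wlen π w := by
  refine csInf_le ⟨0, ?_⟩ ⟨w, hw, rfl, rfl⟩
  rintro r ⟨v, hv, -, rfl⟩
  exact wlen_nonneg hπ hv

theorem exists_wlen_lt_wnorm_add {G : Type*} [Group G] {S : Set G} (π : G → ℝ)
    (hgen : ∀ g : G, ∃ w : List G, (∀ x ∈ w, x ∈ S) ∧ w.prod = g)
    (g : G) {ε : ℝ} (hε : 0 < ε) :
    ∃ w : List G, (∀ x ∈ w, x ∈ S) ∧ w.prod = g ∧ wlen π w < wnorm S π g + ε := by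
  obtain ⟨w₀, hw₀, hg₀⟩ := hgen g
  obtain ⟨r, ⟨w, hw, hg, rfl⟩, hr⟩ := exists_lt_of_csInf_lt
    (s := {r : ℝ | ∃ w : List G, (∀ x ∈ w, x ∈ S) ∧ w.prod = g ∧ wlen π w = r})
    ⟨_, w₀, hw₀, hg₀, rfl⟩ (lt_add_of_pos_right (wnorm S π g) hε)
  exact ⟨w, hw, hg, hr⟩

theorem wnorm_mul_le {G : Type*} [Group G] {S : Set G} {π : G → ℝ}
    (hgen : ∀ g : G, ∃ w : List G, (∀ x ∈ w, x ∈ S) ∧ w.prod = g)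
    (hπ : ∀ s ∈ S, 0 < π s) (g h : G) :
    wnorm S π (g * h) ≤ wnorm S π g + wnorm S π h := by
  refine le_of_forall_pos_le_add fun ε hε => ?_
  obtain ⟨v, hv, rfl, hvlt⟩ := exists_wlen_lt_wnorm_add π hgen g (half_pos hε)
  obtain ⟨w, hw, rfl, hwlt⟩ := exists_wlen_lt_wnorm_add π hgen h (half_pos hε)
  have hvw : ∀ x ∈ v ++ w, x ∈ S := fun x hx =>
    (List.mem_append.1 hx).elim (hv x) (hw x)
  have := wnorm_prod_le hπ hvw
  rw [List.prod_append, wlen_append] at this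
  linarith

theorem WreathEmbedding.sum_wnorm_sec_mul_le {G : Type*} [Group G] {Alp : Type*} [Fintype Alp]
    (ψ : WreathEmbedding G Alp) {S : Set G} {π : G → ℝ}
    (hgen : ∀ g : G, ∃ w : List G, (∀ x ∈ w, x ∈ S) ∧ w.prod = g)
    (hπ : ∀ s ∈ S, 0 < π s) (g h : G) :
    ∑ x : Alp, wnorm S π (ψ.sec (g * h) x) ≤
      ∑ x : Alp, wnorm S π (ψ.sec g x) + ∑ x : Alp, wnorm S π (ψ.sec h x) := by
  rw [← Equiv.sum_comp (ψ.act g)⁻¹ fun x => wnorm S π (ψ.sec h x), ← Finset.sum_add_distrib]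
  refine Finset.sum_le_sum fun x _ => ?_
  rw [ψ.sec_mul]
  exact wnorm_mul_le hgen hπ _ _

theorem WreathEmbedding.sum_wnorm_sec_flatten_append_le {G : Type*} [Group G] {Alp : Type*}
    [Fintype Alp] (ψ : WreathEmbedding G Alp) {S : Set G} {π : G → ℝ}
    (hgen : ∀ g : G, ∃ w : List G, (∀ x ∈ w, x ∈ S) ∧ w.prod = g)
    (hπ : ∀ s ∈ S, 0 < π s) {Δ : Set (List G)} (hΔ : ∀ w ∈ Δ, ∀ x ∈ w, x ∈ S)
    {η : ℝ} (hη : 0 ≤ η)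
    (hcontr : ∀ δ ∈ Δ, ∑ x : Alp, wnorm S π (ψ.sec δ.prod x) ≤ η * wnorm S π δ.prod)
    (ds : List (List G)) (hds : ∀ d ∈ ds, d ∈ Δ) (h : List G) :
    ∑ x : Alp, wnorm S π (ψ.sec (ds.flatten ++ h).prod x) ≤
      η * wlen π ds.flatten + ∑ x : Alp, wnorm S π (ψ.sec h.prod x) := by
  induction ds with
  | nil => simp [wlen]
  | cons d ds ih =>
    have hd : d ∈ Δ := hds d List.mem_cons_self
    have ih' := ih fun e he => hds e (List.mem_cons_of_mem d he)
    have hmul := ψ.sum_wnorm_sec_mul_le hgen hπ d.prod (ds.flatten ++ h).prod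
    have hlen := mul_le_mul_of_nonneg_left (wnorm_prod_le hπ (hΔ d hd)) hη
    have hd' := hcontr d hd
    rw [List.flatten_cons, List.append_assoc, List.prod_append, wlen_append, mul_add]
    linarith

/-- if every word `δ` of an egg `Δ` is strongly contracting with ratio `η`,
then every element `g ∈ G` satisfies `Σ_x ‖g_x‖ ≤ η‖g‖ + c₀` for some constant `c₀ > 0`. -/
theorem contraction_of_egg {G : Type*} [Group G]
    (Alp : Type*) [Fintype Alp] (ψ : WreathEmbedding G Alp)
    (S : Set G) (π : G → ℝ)
    (hSfin : S.Finite) (hone : (1 : G) ∉ S)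
    (hgen : ∀ g : G, ∃ w : List G, (∀ x ∈ w, x ∈ S) ∧ w.prod = g)
    (hπ : ∀ s ∈ S, 0 < π s)
    (Δ : Set (List G)) (hΔ : IsEgg S π Δ)
    (η : ℝ) (hη : η ∈ Set.Icc (0 : ℝ) 1)
    (hcontr : ∀ δ ∈ Δ, ∑ x : Alp, wnorm S π (ψ.sec δ.prod x) ≤ η * wnorm S π δ.prod) :
    ∃ c₀ : ℝ, 0 < c₀ ∧ ∀ g : G,
      ∑ x : Alp, wnorm S π (ψ.sec g x) ≤ η * wnorm S π g + c₀ := by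
  obtain ⟨-, hΔS, F, hF, hFS, hrep⟩ := hΔ
  obtain ⟨C, hC⟩ :=
    (hF.image fun h : List G => ∑ x : Alp, wnorm S π (ψ.sec h.prod x)).bddAbove
  refine ⟨max C 1, lt_max_of_lt_right one_pos, fun g => ?_⟩
  obtain ⟨ds, h, hds, hh, rfl, hlen⟩ := hrep g
  have hsum := ψ.sum_wnorm_sec_flatten_append_le hgen hπ hΔS hη.1 hcontr ds hds h
  have hCh := (hC (Set.mem_image_of_mem _ hh)).trans (le_max_left C 1)
  have hnonneg := mul_nonneg hη.1 (wlen_nonneg hπ (hFS h hh))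
  rw [← hlen, wlen_append, mul_add]
  linarith
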